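/- Let Ω be a quiver. The Tits form of Ω is positive definite on the root space (meaning: for every nonzero element n of the root space for which ⟨n,n⟩_Ω exists, ⟨n,n⟩_Ω is a positive integer or +∞) if and only if for every finite IC subquiver Ω' of Ω the Tits form ⟨·,·⟩_{Ω'} is positive definite on functions Ω'₀ → ℤ (meaning ⟨n,n⟩_{Ω'} > 0 for every nonzero n : Ω'₀ → ℤ). -/

import Mathlib

/-- A quiver: a set of vertices, a set of arrows, with source and target maps. -/
structure Quiv : Type 1 where
  V : Type
  A : Type
  s : A → V
  t : A → V
/-- Adjacency in the underlying graph of a quiver. -/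
def Quiv.Adj (Q : Quiv) (i j : Q.V) : Prop :=
  ∃ a : Q.A, (Q.s a = i ∧ Q.t a = j) ∨ (Q.s a = j ∧ Q.t a = i)

/-- The underlying graph is connected. -/
def Quiv.Connected (Q : Quiv) : Prop :=
  ∀ i j : Q.V, Relation.ReflTransGen Q.Adj i j

/-- Source of an oriented edge-traversal (arrow plus direction of traversal). -/
def Quiv.esrc (Q : Quiv) (p : Q.A × Bool) : Q.V := if p.2 then Q.s p.1 else Q.t p.1

/-- Target of an oriented edge-traversal. -/
def Quiv.etgt (Q : Quiv) (p : Q.A × Bool) : Q.V := if p.2 then Q.t p.1 else Q.s p.1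

/-- `e 0, …, e (n-1)` is a cycle: a closed walk of positive length in the underlying
graph traversing no edge twice. -/
def Quiv.IsCycle (Q : Quiv) (n : ℕ) (e : ℕ → Q.A × Bool) : Prop :=
  0 < n ∧ (∀ k < n, Q.etgt (e k) = Q.esrc (e ((k + 1) % n))) ∧
    (∀ j < n, ∀ k < n, (e j).1 = (e k).1 → j = k)

/-- The quiver has no cycles in its underlying graph. -/
def Quiv.NoCycles (Q : Quiv) : Prop := ¬ ∃ (n : ℕ) (e : ℕ → Q.A × Bool), Q.IsCycle n e

/-- A tree quiver: connected underlying graph with no cycles. -/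
def Quiv.IsTree (Q : Quiv) : Prop := Q.Connected ∧ Q.NoCycles
/-- A subquiver: a set of vertices and a set of arrows whose endpoints lie in it. -/
structure Subquiv (Q : Quiv) : Type where
  verts : Set Q.V
  arrows : Set Q.A
  src_mem : ∀ a ∈ arrows, Q.s a ∈ verts
  tgt_mem : ∀ a ∈ arrows, Q.t a ∈ verts

namespace Subquiv

variable {Q : Quiv}

/-- A subquiver is finite if it has finitely many vertices and arrows. -/
def Finite (S : Subquiv Q) : Prop := S.verts.Finite ∧ S.arrows.Finite

/-- Containment of subquivers. -/
def le (S T : Subquiv Q) : Prop := S.verts ⊆ T.verts ∧ S.arrows ⊆ T.arrows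

/-- Adjacency within a subquiver. -/
def Adj (S : Subquiv Q) (i j : Q.V) : Prop :=
  ∃ a ∈ S.arrows, (Q.s a = i ∧ Q.t a = j) ∨ (Q.s a = j ∧ Q.t a = i)

/-- A subquiver is IC ("injective on components") if no connected component of `Ω`
contains two distinct connected components of the subquiver; equivalently, any two
vertices of the subquiver joined by a walk in `Ω` are joined by a walk in the
subquiver. -/
def IsIC (S : Subquiv Q) : Prop :=
  ∀ i ∈ S.verts, ∀ j ∈ S.verts,
    Relation.ReflTransGen Q.Adj i j → Relation.ReflTransGen S.Adj i j

/-- A subquiver regarded as a quiver in its own right. -/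
def toQuiv (S : Subquiv Q) : Quiv where
  V := ↥S.verts
  A := ↥S.arrows
  s a := ⟨Q.s a.1, S.src_mem a.1 a.2⟩
  t a := ⟨Q.t a.1, S.tgt_mem a.1 a.2⟩

end Subquiv

/-- The directed set of finite IC subquivers of `Q`, preordered by inclusion. -/
def FinICSub (Q : Quiv) : Type := {S : Subquiv Q // S.Finite ∧ S.IsIC}

instance (Q : Quiv) : Preorder (FinICSub Q) where
  le S T := S.1.le T.1
  le_refl S := ⟨subset_rfl, subset_rfl⟩
  le_trans S T U h h' := ⟨h.1.trans h'.1, h.2.trans h'.2⟩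

/-- The Tits form of `n` on a (finite) subquiver:
`Σ_{i ∈ Ω'₀} n_i² − Σ_{a ∈ Ω'₁} n_{s(a)} n_{t(a)}`. -/
noncomputable def tits (Q : Quiv) (n : Q.V → ℤ) (S : Subquiv Q) : ℤ :=
  (∑ᶠ i ∈ S.verts, n i ^ 2) - ∑ᶠ a ∈ S.arrows, n (Q.s a) * n (Q.t a)

/-- Membership of `n` in the root space of `Q`: `n` is constant along all but finitely
many arrows. -/
def IsRoot (Q : Quiv) (n : Q.V → ℤ) : Prop := {a : Q.A | n (Q.s a) ≠ n (Q.t a)}.Finite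

/-- The support of `n`: the full subquiver on the vertices where `n` is nonzero. -/
def suppQuiv (Q : Quiv) (n : Q.V → ℤ) : Subquiv Q where
  verts := {i | n i ≠ 0}
  arrows := {a | n (Q.s a) ≠ 0 ∧ n (Q.t a) ≠ 0}
  src_mem _ ha := ha.1
  tgt_mem _ ha := ha.2

/-- The net of values of the Tits form of `n` over the directed set of finite IC
subquivers, viewed in the extended reals `ℤ ∪ {±∞} ⊆ [-∞,∞]`. -/
noncomputable def titsNet (Q : Quiv) (n : Q.V → ℤ) : FinICSub Q → EReal :=
  fun S => (((tits Q n S.1 : ℤ) : ℝ) : EReal)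

/-- A quiver has finitely many connected components. -/
def Quiv.ComponentsFinite (Q : Quiv) : Prop :=
  ∃ s : Set Q.V, s.Finite ∧ ∀ v : Q.V, ∃ w ∈ s, Relation.ReflTransGen Q.Adj w v

/-- A quiver has finitely many cycles: the set of edge sets of cycles is finite. -/
def Quiv.CyclesFinite (Q : Quiv) : Prop :=
  {s : Set Q.A | ∃ (n : ℕ) (e : ℕ → Q.A × Bool),
    Q.IsCycle n e ∧ s = {a | ∃ k < n, a = (e k).1}}.Finite

namespace Subquiv

variable {Q : Quiv}

lemma Adj.symm {S : Subquiv Q} {i j : Q.V} (h : S.Adj i j) : S.Adj j i := by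
  obtain ⟨a, ha, h⟩ := h
  exact ⟨a, ha, h.symm⟩

lemma reflTransGen_symm {S : Subquiv Q} {i j : Q.V} (h : Relation.ReflTransGen S.Adj i j) :
    Relation.ReflTransGen S.Adj j i :=
  have : Std.Symm S.Adj := ⟨fun _ _ => Adj.symm⟩
  symm_of _ h

lemma reflTransGen_mono {S T : Subquiv Q} (h : S.le T) {i j : Q.V}
    (hij : Relation.ReflTransGen S.Adj i j) : Relation.ReflTransGen T.Adj i j :=
  Relation.ReflTransGen.mono (fun _ _ ⟨a, ha, hs⟩ => ⟨a, h.2 ha, hs⟩) _ _ hij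

lemma quivAdj_reflTransGen {S : Subquiv Q} {i j : Q.V}
    (hij : Relation.ReflTransGen S.Adj i j) : Relation.ReflTransGen Q.Adj i j :=
  Relation.ReflTransGen.mono (fun _ _ ⟨a, _, hs⟩ => ⟨a, hs⟩) _ _ hij

/-- An enlargement of an IC subquiver, all of whose vertices are joined to the original one,
is IC. -/
lemma IsIC.of_le {S T : Subquiv Q} (hS : S.IsIC) (h : S.le T)
    (hT : ∀ i ∈ T.verts, ∃ k ∈ S.verts, Relation.ReflTransGen T.Adj i k) : T.IsIC := by
  intro i hi j hj hij
  obtain ⟨k, hk, hik⟩ := hT i hi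
  obtain ⟨l, hl, hjl⟩ := hT j hj
  have hkl : Relation.ReflTransGen Q.Adj k l :=
    ((quivAdj_reflTransGen (reflTransGen_symm hik)).trans hij).trans (quivAdj_reflTransGen hjl)
  exact (hik.trans (reflTransGen_mono h (hS k hk l hl hkl))).trans (reflTransGen_symm hjl)

/-- Adjoin an arrow together with its endpoints. -/
def addArrow (S : Subquiv Q) (a : Q.A) : Subquiv Q where
  verts := insert (Q.s a) (insert (Q.t a) S.verts)
  arrows := insert a S.arrows
  src_mem := by
    rintro b (rfl | hb)
    · exact Or.inl rfl
    · exact Or.inr (Or.inr (S.src_mem b hb))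
  tgt_mem := by
    rintro b (rfl | hb)
    · exact Or.inr (Or.inl rfl)
    · exact Or.inr (Or.inr (S.tgt_mem b hb))

lemma le_addArrow (S : Subquiv Q) (a : Q.A) : S.le (S.addArrow a) :=
  ⟨fun _ h => Or.inr (Or.inr h), fun _ h => Or.inr h⟩

lemma Finite.addArrow {S : Subquiv Q} (h : S.Finite) (a : Q.A) : (S.addArrow a).Finite :=
  ⟨(h.1.insert _).insert _, h.2.insert _⟩

lemma IsIC.addArrow {S : Subquiv Q} (hS : S.IsIC) {a : Q.A}
    (ha : Q.s a ∈ S.verts ∨ Q.t a ∈ S.verts) : (S.addArrow a).IsIC := by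
  have hadj : (S.addArrow a).Adj (Q.s a) (Q.t a) := ⟨a, Or.inl rfl, Or.inl ⟨rfl, rfl⟩⟩
  refine hS.of_le (S.le_addArrow a) ?_
  rintro i (rfl | rfl | hi)
  · rcases ha with h | h
    · exact ⟨_, h, .refl⟩
    · exact ⟨_, h, .single hadj⟩
  · rcases ha with h | h
    · exact ⟨_, h, .single hadj.symm⟩
    · exact ⟨_, h, .refl⟩
  · exact ⟨i, hi, .refl⟩

/-- Adjoin a vertex. -/
def addVertex (S : Subquiv Q) (v : Q.V) : Subquiv Q where
  verts := insert v S.verts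
  arrows := S.arrows
  src_mem a ha := Or.inr (S.src_mem a ha)
  tgt_mem a ha := Or.inr (S.tgt_mem a ha)

lemma le_addVertex (S : Subquiv Q) (v : Q.V) : S.le (S.addVertex v) :=
  ⟨fun _ h => Or.inr h, fun _ h => h⟩

lemma IsIC.addVertex {S : Subquiv Q} (hS : S.IsIC) {v : Q.V}
    (hv : ∀ w ∈ S.verts, ¬ Relation.ReflTransGen Q.Adj w v) : (S.addVertex v).IsIC := by
  have : Std.Symm Q.Adj := ⟨fun _ _ ⟨a, ha⟩ => ⟨a, ha.symm⟩⟩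
  rintro i (rfl | hi) j (rfl | hj) hij
  · exact .refl
  · exact absurd (symm_of _ hij) (hv j hj)
  · exact absurd hij (hv i hi)
  · exact reflTransGen_mono (S.le_addVertex v) (hS i hi j hj hij)

/-- A finite IC subquiver can be extended along a walk. -/
lemma exists_le_mem_of_reflTransGen {S : Subquiv Q} (hf : S.Finite) (hS : S.IsIC) {w v : Q.V}
    (hw : w ∈ S.verts) (h : Relation.ReflTransGen Q.Adj w v) :
    ∃ T : Subquiv Q, T.Finite ∧ T.IsIC ∧ S.le T ∧ v ∈ T.verts := by
  induction h with
  | refl => exact ⟨S, hf, hS, ⟨subset_rfl, subset_rfl⟩, hw⟩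
  | tail _ hadj ih =>
    obtain ⟨T, hTf, hT, hST, hv⟩ := ih
    obtain ⟨a, ⟨rfl, rfl⟩ | ⟨rfl, rfl⟩⟩ := hadj
    · exact ⟨T.addArrow a, hTf.addArrow a, hT.addArrow (.inl hv),
        ⟨hST.1.trans (T.le_addArrow a).1, hST.2.trans (T.le_addArrow a).2⟩, .inr (.inl rfl)⟩
    · exact ⟨T.addArrow a, hTf.addArrow a, hT.addArrow (.inr hv),
        ⟨hST.1.trans (T.le_addArrow a).1, hST.2.trans (T.le_addArrow a).2⟩, .inl rfl⟩

/-- Every finite set of vertices lies in a finite IC subquiver. -/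
lemma exists_finite_isIC {F : Set Q.V} (hF : F.Finite) :
    ∃ T : Subquiv Q, T.Finite ∧ T.IsIC ∧ F ⊆ T.verts := by
  induction F, hF using Set.Finite.induction_on with
  | empty =>
    exact ⟨⟨∅, ∅, by simp, by simp⟩, ⟨Set.finite_empty, Set.finite_empty⟩,
      fun i hi => absurd hi (Set.notMem_empty i), subset_rfl⟩
  | @insert v F _ _ ih =>
    obtain ⟨T, hTf, hT, hFT⟩ := ih
    by_cases h : ∃ w ∈ T.verts, Relation.ReflTransGen Q.Adj w v
    · obtain ⟨w, hw, hwv⟩ := h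
      obtain ⟨U, hUf, hU, hTU, hv⟩ := exists_le_mem_of_reflTransGen hTf hT hw hwv
      exact ⟨U, hUf, hU, Set.insert_subset hv (hFT.trans hTU.1)⟩
    · push Not at h
      exact ⟨T.addVertex v, ⟨hTf.1.insert _, hTf.2⟩, hT.addVertex h, Set.insert_subset_insert hFT⟩

end Subquiv

lemma FinICSub.exists_le_le {Q : Quiv} (S T : FinICSub Q) : ∃ U : FinICSub Q, S ≤ U ∧ T ≤ U := by
  obtain ⟨W, hWf, hW, hsub⟩ := Subquiv.exists_finite_isIC (S.2.1.1.union T.2.1.1)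
  rw [Set.union_subset_iff] at hsub
  let U : Subquiv Q :=
    { verts := W.verts
      arrows := W.arrows ∪ (S.1.arrows ∪ T.1.arrows)
      src_mem := by
        rintro a (h | h | h)
        exacts [W.src_mem a h, hsub.1 (S.1.src_mem a h), hsub.2 (T.1.src_mem a h)]
      tgt_mem := by
        rintro a (h | h | h)
        exacts [W.tgt_mem a h, hsub.1 (S.1.tgt_mem a h), hsub.2 (T.1.tgt_mem a h)] }
  have hU : U.IsIC :=
    hW.of_le ⟨subset_rfl, Set.subset_union_left⟩ fun i hi => ⟨i, hi, .refl⟩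
  exact ⟨⟨U, ⟨hWf.1, hWf.2.union (S.2.1.2.union T.2.1.2)⟩, hU⟩,
    ⟨hsub.1, Set.subset_union_left.trans Set.subset_union_right⟩,
    ⟨hsub.2, Set.subset_union_right.trans Set.subset_union_right⟩⟩

instance (Q : Quiv) : IsDirectedOrder (FinICSub Q) := ⟨FinICSub.exists_le_le⟩

/-- The subquiver with a single vertex and no arrows. -/
def FinICSub.single {Q : Quiv} (v : Q.V) : FinICSub Q :=
  ⟨⟨{v}, ∅, by simp, by simp⟩, ⟨Set.finite_singleton v, Set.finite_empty⟩, by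
    rintro i rfl j rfl _
    exact .refl⟩

lemma tits_single {Q : Quiv} (n : Q.V → ℤ) (v : Q.V) :
    tits Q n (FinICSub.single v).1 = n v ^ 2 := by
  simp [tits, FinICSub.single]

lemma tits_eq_sub {Q : Quiv} (n : Q.V → ℤ) {S T : Subquiv Q} (hT : T.Finite) (h : S.le T) :
    tits Q n T = tits Q n S + (∑ᶠ i ∈ T.verts \ S.verts, n i ^ 2) -
      ∑ᶠ a ∈ T.arrows \ S.arrows, n (Q.s a) * n (Q.t a) := by
  unfold tits
  rw [← finsum_mem_add_sdiff h.1 hT.1, ← finsum_mem_add_sdiff h.2 hT.2]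
  ring

/-- `n` is constant along the arrows outside `S` and vanishes on the components of `Q`
which do not meet `S`. -/
def ConstOutside {Q : Quiv} (n : Q.V → ℤ) (S : Subquiv Q) : Prop :=
  (∀ a ∉ S.arrows, n (Q.s a) = n (Q.t a)) ∧
    ∀ v, n v ≠ 0 → ∃ w ∈ S.verts, Relation.ReflTransGen Q.Adj w v

lemma ConstOutside.mono {Q : Quiv} {n : Q.V → ℤ} {S T : Subquiv Q} (hn : ConstOutside n S)
    (h : S.le T) : ConstOutside n T :=
  ⟨fun a ha => hn.1 a fun h' => ha (h.2 h'), fun v hv =>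
    let ⟨w, hw, hwv⟩ := hn.2 v hv
    ⟨w, h.1 hw, hwv⟩⟩

lemma tits_addArrow {Q : Quiv} (n : Q.V → ℤ) {S : Subquiv Q} (hS : S.Finite) {a : Q.A}
    (ha : a ∉ S.arrows) : tits Q n (S.addArrow a) = tits Q n S +
      (∑ᶠ i ∈ (S.addArrow a).verts \ S.verts, n i ^ 2) - n (Q.s a) * n (Q.t a) := by
  rw [tits_eq_sub n (hS.addArrow a) (S.le_addArrow a)]
  have : (S.addArrow a).arrows \ S.arrows = {a} := by
    ext b
    simp only [Subquiv.addArrow, Set.mem_sdiff, Set.mem_insert_iff, Set.mem_singleton_iff]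
    grind
  rw [this, finsum_mem_singleton]

/-- Adjoining a leaf does not change the Tits form of a function which is constant along the
new arrow. -/
lemma tits_addArrow_of_leaf {Q : Quiv} (n : Q.V → ℤ) {S : Subquiv Q} (hS : S.Finite) {a : Q.A}
    (hn : n (Q.s a) = n (Q.t a))
    (ha : (Q.s a ∈ S.verts ∧ Q.t a ∉ S.verts) ∨ (Q.t a ∈ S.verts ∧ Q.s a ∉ S.verts)) :
    tits Q n (S.addArrow a) = tits Q n S := by
  have haS : a ∉ S.arrows := fun h => by
    have h1 := S.src_mem a h
    have h2 := S.tgt_mem a h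
    tauto
  rw [tits_addArrow n hS haS]
  rcases ha with ha | ha
  · have : (S.addArrow a).verts \ S.verts = {Q.t a} := by
      ext b
      simp only [Subquiv.addArrow, Set.mem_sdiff, Set.mem_insert_iff, Set.mem_singleton_iff]
      grind
    rw [this, finsum_mem_singleton, hn]
    ring
  · have : (S.addArrow a).verts \ S.verts = {Q.s a} := by
      ext b
      simp only [Subquiv.addArrow, Set.mem_sdiff, Set.mem_insert_iff, Set.mem_singleton_iff]
      grind
    rw [this, finsum_mem_singleton, hn]
    ring

lemma tits_le_of_le {Q : Quiv} {n : Q.V → ℤ} {S T : Subquiv Q} (hS : S.Finite)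
    (hT : T.Finite) (hTIC : T.IsIC) (h : S.le T) (hn : ConstOutside n S) :
    tits Q n T ≤ tits Q n S := by
  induction hk : (T.verts \ S.verts).ncard using Nat.strong_induction_on generalizing S with
  | _ k ih =>
  by_cases hex : ∃ a ∈ T.arrows,
      (Q.s a ∈ S.verts ∧ Q.t a ∉ S.verts) ∨ (Q.t a ∈ S.verts ∧ Q.s a ∉ S.verts)
  · obtain ⟨a, haT, ha⟩ := hex
    have haS : a ∉ S.arrows := fun h => by
      have h1 := S.src_mem a h
      have h2 := S.tgt_mem a h
      tauto
    have hle : (S.addArrow a).le T :=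
      ⟨Set.insert_subset (T.src_mem a haT) (Set.insert_subset (T.tgt_mem a haT) h.1),
        Set.insert_subset haT h.2⟩
    have hlt : (T.verts \ (S.addArrow a).verts).ncard < k := by
      rw [← hk]
      refine Set.ncard_lt_ncard ?_ hT.1.sdiff
      refine ⟨Set.sdiff_subset_sdiff_right (S.le_addArrow a).1, fun hsub => ?_⟩
      rcases ha with ha | ha
      · exact (hsub ⟨T.tgt_mem a haT, ha.2⟩).2 (.inr (.inl rfl))
      · exact (hsub ⟨T.src_mem a haT, ha.2⟩).2 (.inl rfl)
    exact (ih _ hlt (hS.addArrow a) hle (hn.mono (S.le_addArrow a)) rfl).trans_eq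
      (tits_addArrow_of_leaf n hS (hn.1 a haS) ha)
  · push Not at hex
    have hzero : ∀ v ∈ T.verts \ S.verts, n v ^ 2 = 0 := by
      intro v hv
      by_contra hnv
      obtain ⟨w, hw, hwv⟩ := hn.2 v fun h0 => hnv (by simp [h0])
      refine hv.2 ?_
      have hwalk := hTIC w (h.1 hw) v hv.1 hwv
      clear hnv hwv hv
      induction hwalk with
      | refl => exact hw
      | tail _ hadj ih' =>
        obtain ⟨a, haT, ⟨rfl, rfl⟩ | ⟨rfl, rfl⟩⟩ := hadj
        · exact (hex a haT).1 ih'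
        · exact (hex a haT).2 ih'
    have hnonneg : 0 ≤ ∑ᶠ a ∈ T.arrows \ S.arrows, n (Q.s a) * n (Q.t a) :=
      finsum_nonneg fun a => finsum_nonneg fun ha => by
        rw [hn.1 a ha.2]
        exact mul_self_nonneg _
    rw [tits_eq_sub n hT h, finsum_mem_eq_zero_of_forall_eq_zero hzero]
    linarith

lemma titsNet_le_titsNet {Q : Quiv} {n : Q.V → ℤ} {S T : FinICSub Q}
    (h : tits Q n S.1 ≤ tits Q n T.1) : titsNet Q n S ≤ titsNet Q n T := by
  simpa [titsNet] using h

/-- The net of Tits forms of a function which is constant outside `S` is eventually antitone,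
so it converges. -/
lemma ConstOutside.tendsto_titsNet {Q : Quiv} {n : Q.V → ℤ} {S : FinICSub Q}
    (hn : ConstOutside n S.1) : Filter.Tendsto (titsNet Q n) Filter.atTop
      (nhds (⨅ T : Set.Ici S, titsNet Q n T)) := by
  refine tendsto_order.2 ⟨fun x hx => ?_, fun x hx => ?_⟩
  · filter_upwards [Filter.eventually_ge_atTop S] with T hT
    exact hx.trans_le (iInf_le (fun T : Set.Ici S => titsNet Q n T) ⟨T, hT⟩)
  · obtain ⟨⟨T, hST⟩, hT⟩ := iInf_lt_iff.1 hx
    filter_upwards [Filter.eventually_ge_atTop T] with U hU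
    exact (titsNet_le_titsNet
      (tits_le_of_le T.2.1 U.2.1 U.2.2 hU (hn.mono hST))).trans_lt hT

/-- The Tits form of `Q` takes positive values on the root space. -/
def TitsPos (Q : Quiv) : Prop :=
  ∀ n : Q.V → ℤ, IsRoot Q n → (∃ i, n i ≠ 0) →
    ∀ L : EReal, Filter.Tendsto (titsNet Q n) Filter.atTop (nhds L) → 0 < L

lemma TitsPos.tits_pos {Q : Quiv} (hQ : TitsPos Q) {n : Q.V → ℤ} {S : FinICSub Q}
    (hn : ConstOutside n S.1) (hne : ∃ i, n i ≠ 0) : 0 < tits Q n S.1 := by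
  have hroot : IsRoot Q n := S.2.1.2.subset fun a ha => by
    by_contra h
    exact ha (hn.1 a h)
  have h := (hQ n hroot hne _ hn.tendsto_titsNet).trans_le
    (iInf_le (fun T : Set.Ici S => titsNet Q n T) ⟨S, Set.mem_Ici.2 le_rfl⟩)
  simpa [titsNet] using h

/-- If the Tits form is positive on roots then finite IC subquivers are full, which says that
the underlying graph is a forest. -/
lemma TitsPos.mem_arrows {Q : Quiv} (hQ : TitsPos Q) (T : FinICSub Q) {a : Q.A}
    (hs : Q.s a ∈ T.1.verts) (ht : Q.t a ∈ T.1.verts) : a ∈ T.1.arrows := by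
  classical
  by_contra ha
  let n : Q.V → ℤ := fun v => if Relation.ReflTransGen Q.Adj (Q.s a) v then 1 else 0
  have hns : n (Q.s a) = 1 := if_pos .refl
  have hnt : n (Q.t a) = 1 := if_pos (.single ⟨a, .inl ⟨rfl, rfl⟩⟩)
  have hn : ConstOutside n (FinICSub.single (Q.s a)).1 := by
    refine ⟨fun b _ => ?_, fun v hv => ⟨Q.s a, rfl, ?_⟩⟩
    · have : Relation.ReflTransGen Q.Adj (Q.s a) (Q.s b) ↔
          Relation.ReflTransGen Q.Adj (Q.s a) (Q.t b) :=
        ⟨fun h => h.tail ⟨b, .inl ⟨rfl, rfl⟩⟩, fun h => h.tail ⟨b, .inr ⟨rfl, rfl⟩⟩⟩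
      simp only [n, this]
    · by_contra h
      exact hv (if_neg h)
  have hle : (FinICSub.single (Q.s a)).1.le T.1 :=
    ⟨Set.singleton_subset_iff.2 hs, Set.empty_subset _⟩
  have h1 : tits Q n T.1 ≤ 1 := by
    have := tits_le_of_le (FinICSub.single (Q.s a)).2.1 T.2.1 T.2.2 hle hn
    rwa [tits_single, hns, one_pow] at this
  let U : FinICSub Q := ⟨T.1.addArrow a, T.2.1.addArrow a, T.2.2.addArrow (.inl hs)⟩
  have h2 : 0 < tits Q n U.1 :=
    hQ.tits_pos ((hn.mono hle).mono (T.1.le_addArrow a)) ⟨Q.s a, by simp [hns]⟩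
  have hempty : (T.1.addArrow a).verts \ T.1.verts = ∅ :=
    Set.sdiff_eq_empty.2 (Set.insert_subset hs (Set.insert_subset ht subset_rfl))
  have h3 : tits Q n U.1 = tits Q n T.1 + 0 - 1 := by
    rw [tits_addArrow n T.2.1 ha, hempty, finsum_mem_empty, hns, hnt, one_mul]
  linarith

/-- Adjacency through an arrow outside `S`. -/
def OutsideAdj {Q : Quiv} (S : Subquiv Q) (i j : Q.V) : Prop :=
  ∃ a ∉ S.arrows, (Q.s a = i ∧ Q.t a = j) ∨ (Q.s a = j ∧ Q.t a = i)

/-- A walk outside `S` starting at `i ∈ S` stays in a finite IC subquiver which retracts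
onto `S`, contracting the walk to `i`. -/
lemma TitsPos.exists_retraction {Q : Quiv} (hQ : TitsPos Q) (S : FinICSub Q) {i v : Q.V}
    (hi : i ∈ S.1.verts) (h : Relation.ReflTransGen (OutsideAdj S.1) i v) :
    ∃ (T : FinICSub Q) (r : Q.V → Q.V), S ≤ T ∧ v ∈ T.1.verts ∧ (∀ w ∈ S.1.verts, r w = w) ∧
      (∀ a ∈ T.1.arrows, a ∉ S.1.arrows → r (Q.s a) = r (Q.t a)) ∧ r v = i := by
  classical
  induction h with
  | refl => exact ⟨S, id, le_rfl, hi, fun _ _ => rfl, fun a h h' => absurd h h', rfl⟩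
  | @tail u v _ hadj ih =>
    obtain ⟨T, r, hST, hu, hr, hra, hru⟩ := ih
    obtain ⟨a, haS, ha⟩ := hadj
    by_cases hv : v ∈ T.1.verts
    · have haT : a ∈ T.1.arrows := by
        apply hQ.mem_arrows T <;> grind
      have := hra a haT haS
      exact ⟨T, r, hST, hv, hr, hra, by grind⟩
    · have hvu : u ≠ v := fun h => hv (h ▸ hu)
      refine ⟨⟨T.1.addArrow a, T.2.1.addArrow a, T.2.2.addArrow (by grind)⟩,
        Function.update r v i, hST.trans (T.1.le_addArrow a), ?_, ?_, ?_, by simp⟩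
      · simp only [Subquiv.addArrow, Set.mem_insert_iff]
        grind
      · intro w hw
        have hwv : w ≠ v := fun h => hv (h ▸ hST.1 hw)
        rw [Function.update_of_ne hwv, hr w hw]
      · rintro b (rfl | hb) hbS
        · rcases ha with ⟨h1, h2⟩ | ⟨h1, h2⟩ <;> simp [h1, h2, hvu, hru]
        · have h1 : Q.s b ≠ v := fun h => hv (h ▸ T.1.src_mem b hb)
          have h2 : Q.t b ≠ v := fun h => hv (h ▸ T.1.tgt_mem b hb)
          rw [Function.update_of_ne h1, Function.update_of_ne h2, hra b hb hbS]

lemma TitsPos.eq_of_outsideAdj {Q : Quiv} (hQ : TitsPos Q) (S : FinICSub Q) {i j : Q.V}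
    (hi : i ∈ S.1.verts) (hj : j ∈ S.1.verts)
    (h : Relation.ReflTransGen (OutsideAdj S.1) i j) : i = j := by
  obtain ⟨T, r, -, -, hr, -, hrj⟩ := hQ.exists_retraction S hi h
  rw [← hrj, hr j hj]

/-- Functions on a finite IC subquiver extend to roots which are constant outside it. -/
lemma TitsPos.exists_extension {Q : Quiv} (hQ : TitsPos Q) (S : FinICSub Q) (m : Q.V → ℤ) :
    ∃ n : Q.V → ℤ, ConstOutside n S.1 ∧ ∀ i ∈ S.1.verts, n i = m i := by
  classical
  have : Std.Symm (OutsideAdj S.1) := ⟨fun _ _ ⟨a, ha, h⟩ => ⟨a, ha, h.symm⟩⟩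
  let P : Q.V → Q.V → Prop := fun v i => i ∈ S.1.verts ∧ Relation.ReflTransGen (OutsideAdj S.1) i v
  have huniq : ∀ {v i j}, P v i → P v j → i = j := fun {v i j} hi hj =>
    hQ.eq_of_outsideAdj S hi.1 hj.1 (hi.2.trans (symm_of _ hj.2))
  let n : Q.V → ℤ := fun v => if h : ∃ i, P v i then m h.choose else 0
  have hn : ∀ {v i}, P v i → n v = m i := fun {v i} hi => by
    have h : ∃ i, P v i := ⟨i, hi⟩
    simp only [n, dif_pos h]
    rw [huniq h.choose_spec hi]
  refine ⟨n, ⟨fun a ha => ?_, fun v hv => ?_⟩, fun i hi => hn ⟨hi, .refl⟩⟩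
  · have hP : P (Q.s a) = P (Q.t a) := by
      ext i
      exact ⟨fun h => ⟨h.1, h.2.tail ⟨a, ha, .inl ⟨rfl, rfl⟩⟩⟩,
        fun h => ⟨h.1, h.2.tail ⟨a, ha, .inr ⟨rfl, rfl⟩⟩⟩⟩
    simp only [n, hP]
  · have h : ∃ i, P v i := by
      by_contra h
      exact hv (dif_neg h)
    obtain ⟨i, hi, hiv⟩ := h
    exact ⟨i, hi, Relation.ReflTransGen.mono (fun _ _ ⟨a, _, h⟩ => ⟨a, h⟩) _ _ hiv⟩

lemma tits_congr {Q : Quiv} {n m : Q.V → ℤ} {S : Subquiv Q} (h : ∀ i ∈ S.verts, n i = m i) :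
    tits Q n S = tits Q m S := by
  unfold tits
  congr 1
  · exact finsum_mem_congr rfl fun i hi => by rw [h i hi]
  · exact finsum_mem_congr rfl fun a ha => by rw [h _ (S.src_mem a ha), h _ (S.tgt_mem a ha)]

/-- The Tits form of a quiver `Ω` is positive definite on the root
space (every nonzero root whose Tits form converges has positive limit, possibly `+∞`)
iff the Tits form of every finite IC subquiver `Ω'` is positive definite on functions
`Ω'₀ → ℤ`. -/
theorem stmt18 (Q : Quiv) :
    (∀ n : Q.V → ℤ, IsRoot Q n → (∃ i, n i ≠ 0) →
      ∀ L : EReal, Filter.Tendsto (titsNet Q n) Filter.atTop (nhds L) → 0 < L) ↔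
    (∀ S : FinICSub Q, ∀ m : Q.V → ℤ, (∃ i ∈ S.1.verts, m i ≠ 0) → 0 < tits Q m S.1) := by
  constructor
  · intro hQ S m ⟨i, hi, hmi⟩
    obtain ⟨n, hn, hnm⟩ := TitsPos.exists_extension hQ S m
    rw [← tits_congr hnm]
    exact TitsPos.tits_pos hQ hn ⟨i, by rwa [hnm i hi]⟩
  · rintro h n - ⟨i, hi⟩ L hL
    have : Nonempty (FinICSub Q) := ⟨FinICSub.single i⟩
    refine zero_lt_one.trans_le (ge_of_tendsto hL ?_)
    filter_upwards [Filter.eventually_ge_atTop (FinICSub.single i)] with S hS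
    have h1 : 1 ≤ tits Q n S.1 := h S n ⟨i, hS.1 rfl, hi⟩
    have h2 : (1 : ℝ) ≤ (tits Q n S.1 : ℝ) := by exact_mod_cast h1
    exact EReal.coe_le_coe_iff.2 h2
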